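/- arXiv:1712.04866 — 2 statements merged into one kernel-verified Lean document; each statement's English description precedes it below -/
import Mathlib

section
/- Let 2 ≤ k ≤ n and for each J ∈ T^1_{k−1} let D^J ∈ Λ^k satisfy e^1⌟D^J = 0. Assume that Σ_{J∈T^1_{k−1}} ⟨D^J; a∧b⟩⟨a∧b; e^1∧e^J⟩ = 0 for all a ∈ Λ^1 and b ∈ Λ^{k−1}. Then e^R⌟D^S + e^S⌟D^R = 0 for all R, S ∈ T^1_{k−1} (in particular e^R⌟D^R = 0 for all R ∈ T^1_{k−1}). -/
/-! Basic setup: `Λᵏ(ℝⁿ)` in coordinates with respect to the standard basis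
`e^I`, `I` a strictly increasing multi-index (modeled as a `k`-element subset of
`Fin n`), together with the exterior product, interior product, inner product,
Hodge star, and the various notions of one-directional convexity/affinity. -/

/-- Increasing multi-indices of length `k` in `{1,…,n}`: `k`-element subsets of `Fin n`.
`Idx n k` plays the role of `T_k`. -/
abbrev Idx (n k : ℕ) := {s : Finset (Fin n) // s.card = k}

/-- `Λᵏ(ℝⁿ)`, identified with its coordinates in the standard basis `e^I`. -/
abbrev Lam (n k : ℕ) := Idx n k → ℝ

/-- The sign `sgn(R,S)` defined by `e^{[R,S]} = sgn(R,S) e^R ∧ e^S` for disjoint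
increasing multi-indices: `(-1)` to the number of inversions between `R` and `S`. -/
def msign {n : ℕ} (R S : Finset (Fin n)) : ℝ :=
  (-1 : ℝ) ^ (((R ×ˢ S).filter (fun p => p.2 < p.1)).card)

/-- The basis form `e^S` (of degree `k = S.card`; zero if `k ≠ S.card`). -/
def bform {n k : ℕ} (S : Finset (Fin n)) : Lam n k :=
  fun I => if I.1 = S then 1 else 0

/-- Exterior (wedge) product in coordinates.  When `m = k + l` this is the wedge
product `Λᵏ × Λˡ → Λ^{k+l}`; for other `m` it is `0`. -/
def wedge {n k l m : ℕ} (ω : Lam n k) (φ : Lam n l) : Lam n m :=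
  fun I => ∑ R : Idx n k, ∑ S : Idx n l,
    if R.1 ∪ S.1 = I.1 ∧ Disjoint R.1 S.1 then msign R.1 S.1 * (ω R * φ S) else 0

/-- Interior product `a ⌟ b`, characterized by `⟨a ⌟ b; c⟩ = ⟨b; a ∧ c⟩`.  When
`m = k - j` this is the interior product `Λʲ × Λᵏ → Λ^{k-j}`; for other `m` it is `0`. -/
def iprod {n j k m : ℕ} (a : Lam n j) (b : Lam n k) : Lam n m :=
  fun C => ∑ A : Idx n j, ∑ B : Idx n k,
    if A.1 ∪ C.1 = B.1 ∧ Disjoint A.1 C.1 then msign A.1 C.1 * (a A * b B) else 0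

/-- Hodge star with respect to the standard orientation; when `m = n - k` this is
`∗ : Λᵏ → Λ^{n-k}`. -/
def hstar {n k m : ℕ} (ω : Lam n k) : Lam n m :=
  fun J => ∑ I : Idx n k, if I.1 = (J.1)ᶜ then msign I.1 J.1 * ω I else 0

/-- Inner product `⟨·;·⟩` on `Λᵏ` (the basis `e^I` is orthonormal). -/
def ip {n k : ℕ} (ω α : Lam n k) : ℝ := ∑ I : Idx n k, ω I * α I

/-- `s`-fold exterior power `ω^s = ω ∧ ⋯ ∧ ω` (with `ω^0 = 1 ∈ Λ⁰`). -/
def lpow {n k : ℕ} (ω : Lam n k) : (s : ℕ) → Lam n (k * s)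
  | 0 => bform ∅
  | s + 1 => wedge ω (lpow ω s)

/-- `f : Λᵏ → ℝ` is ext. one convex. -/
def ExtOneConvex {n k : ℕ} (f : Lam n k → ℝ) : Prop :=
  ∀ (ω : Lam n k) (a : Lam n 1) (b : Lam n (k-1)),
    ConvexOn ℝ Set.univ (fun t : ℝ => f (ω + t • (wedge a b : Lam n k)))

/-- `f : Λᵏ → ℝ` is ext. one affine. -/
def ExtOneAffine {n k : ℕ} (f : Lam n k → ℝ) : Prop :=
  ExtOneConvex f ∧ ExtOneConvex (fun ω => -f ω)

/-- `f : Λᵏ → ℝ` is int. one convex. -/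
def IntOneConvex {n k : ℕ} (f : Lam n k → ℝ) : Prop :=
  ∀ (ω : Lam n k) (a : Lam n 1) (b : Lam n (k+1)),
    ConvexOn ℝ Set.univ (fun t : ℝ => f (ω + t • (iprod a b : Lam n k)))

/-- `f : Λᵏ → ℝ` is int. one affine. -/
def IntOneAffine {n k : ℕ} (f : Lam n k → ℝ) : Prop :=
  IntOneConvex f ∧ IntOneConvex (fun ω => -f ω)

/-- `f : Λ^{k+1} × Λ^{k-1} → ℝ` is ext-int. one convex. -/
def ExtIntOneConvex {n k : ℕ} (f : Lam n (k+1) → Lam n (k-1) → ℝ) : Prop :=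
  ∀ (ξ : Lam n (k+1)) (η : Lam n (k-1)) (a : Lam n 1) (b : Lam n k),
    ConvexOn ℝ Set.univ
      (fun t : ℝ => f (ξ + t • (wedge a b : Lam n (k+1))) (η + t • (iprod a b : Lam n (k-1))))

/-- `f : Λ^{k+1} × Λ^{k-1} → ℝ` is ext-int. one affine. -/
def ExtIntOneAffine {n k : ℕ} (f : Lam n (k+1) → Lam n (k-1) → ℝ) : Prop :=
  ExtIntOneConvex f ∧ ExtIntOneConvex (fun ξ η => -f ξ η)

/-- `g : Λᵏ → ℝ` is affine, i.e. a constant plus a linear functional. -/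
def AffineFn {n k : ℕ} (g : Lam n k → ℝ) : Prop :=
  ∃ (c : ℝ) (a : Lam n k), ∀ ω, g ω = c + ip a ω

section ExteriorCoordinates

variable {n k l m : ℕ}

theorem ip_add_left (ω φ α : Lam n k) : ip (ω + φ) α = ip ω α + ip φ α := by
  simp [ip, add_mul, Finset.sum_add_distrib]

theorem ip_add_right (ω φ α : Lam n k) : ip α (ω + φ) = ip α ω + ip α φ := by
  simp [ip, mul_add, Finset.sum_add_distrib]

theorem ip_smul_right (c : ℝ) (ω α : Lam n k) : ip α (c • ω) = c * ip α ω := by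
  simp only [ip, Pi.smul_apply, smul_eq_mul, Finset.mul_sum]
  exact Finset.sum_congr rfl fun _ _ => by ring

theorem wedge_add_left (ω ω' : Lam n k) (φ : Lam n l) :
    (wedge (ω + ω') φ : Lam n m) = wedge ω φ + wedge ω' φ := by
  funext I
  simp only [wedge, Pi.add_apply, ← Finset.sum_add_distrib]
  refine Finset.sum_congr rfl fun _ _ => Finset.sum_congr rfl fun _ _ => ?_
  split_ifs <;> ring

theorem wedge_add_right (ω : Lam n k) (φ φ' : Lam n l) :
    (wedge ω (φ + φ') : Lam n m) = wedge ω φ + wedge ω φ' := by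
  funext I
  simp only [wedge, Pi.add_apply, ← Finset.sum_add_distrib]
  refine Finset.sum_congr rfl fun _ _ => Finset.sum_congr rfl fun _ _ => ?_
  split_ifs <;> ring

theorem wedge_bform_bform_apply (P : Idx n k) (Q : Idx n l) (I : Idx n m) :
    (wedge (bform P.1 : Lam n k) (bform Q.1 : Lam n l) : Lam n m) I =
      if P.1 ∪ Q.1 = I.1 ∧ Disjoint P.1 Q.1 then msign P.1 Q.1 else 0 := by
  unfold wedge bform
  rw [Finset.sum_eq_single P, Finset.sum_eq_single Q]
  · simp
  · intro S _ hS
    simp [Subtype.coe_ne_coe.mpr hS]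
  · simp
  · intro R _ hR
    simp [Subtype.coe_ne_coe.mpr hR]
  · simp

theorem iprod_bform_apply (P : Idx n k) (ω : Lam n l) (C : Idx n m) :
    (iprod (bform P.1 : Lam n k) ω : Lam n m) C =
      ip ω (wedge (bform P.1 : Lam n k) (bform C.1 : Lam n m)) := by
  unfold iprod ip
  rw [Finset.sum_eq_single P]
  · refine Finset.sum_congr rfl fun B _ => ?_
    rw [wedge_bform_bform_apply]
    split_ifs <;> simp [bform, mul_comm]
  · intro R _ hR
    simp [bform, Subtype.coe_ne_coe.mpr hR]
  · simp

theorem msign_singleton_comm {c : Fin n} {S : Finset (Fin n)} (h : c ∉ S) :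
    msign S {c} = (-1) ^ S.card * msign {c} S := by
  have hl : ((S ×ˢ {c}).filter fun p : Fin n × Fin n => p.2 < p.1).card =
      (S.filter fun s => c < s).card := by
    rw [Finset.product_singleton, Finset.filter_map, Finset.card_map]
    rfl
  have hr : ((({c} : Finset (Fin n)) ×ˢ S).filter fun p : Fin n × Fin n => p.2 < p.1).card =
      (S.filter fun s => ¬ c < s).card := by
    rw [Finset.singleton_product, Finset.filter_map, Finset.card_map]
    congr 1
    refine Finset.filter_congr fun s hs => ?_
    have : s ≠ c := fun e => h (e ▸ hs)
    simp only [Function.comp, Function.Embedding.coeFn_mk, not_lt]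
    exact ⟨le_of_lt, fun h' => lt_of_le_of_ne h' this⟩
  unfold msign
  rw [hl, hr, ← Finset.card_filter_add_card_filter_not (s := S) (fun s => c < s), pow_add,
    mul_assoc, ← mul_pow]
  simp

theorem wedge_bform_singleton_comm (P : Idx n k) (c : Fin n) :
    (wedge (bform P.1 : Lam n k) (bform {c} : Lam n 1) : Lam n m) =
      (-1 : ℝ) ^ k • wedge (bform {c} : Lam n 1) (bform P.1 : Lam n k) := by
  funext I
  have h₁ := wedge_bform_bform_apply P (⟨{c}, Finset.card_singleton c⟩ : Idx n 1) I
  have h₂ := wedge_bform_bform_apply (⟨{c}, Finset.card_singleton c⟩ : Idx n 1) P I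
  simp only at h₁ h₂
  simp only [Pi.smul_apply, h₁, h₂, Finset.union_comm P.1, disjoint_comm (a := P.1)]
  split_ifs with h
  · rw [msign_singleton_comm (Finset.disjoint_singleton_left.mp h.2), P.2, smul_eq_mul]
  · simp

theorem ip_wedge_bform_singleton {e : Fin n} (hkl : m = k + 1) (P Q : Idx n k)
    (hP : e ∉ P.1) (hQ : e ∉ Q.1) :
    ip (wedge (bform {e} : Lam n 1) (bform P.1 : Lam n k) : Lam n m)
      (wedge (bform {e} : Lam n 1) (bform Q.1 : Lam n k)) = if P = Q then 1 else 0 := by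
  have h (R : Idx n k) (I : Idx n m) :=
    wedge_bform_bform_apply (⟨{e}, Finset.card_singleton e⟩ : Idx n 1) R I
  simp only at h
  have hcard : ({e} ∪ P.1).card = m := by
    rw [Finset.card_union_of_disjoint (by simpa using hP), Finset.card_singleton, P.2, hkl,
      add_comm]
  unfold ip
  rw [Finset.sum_eq_single (⟨{e} ∪ P.1, hcard⟩ : Idx n m)]
  · simp only [h, Finset.disjoint_singleton_left, hP, hQ, not_false_eq_true, and_self, and_true,
      if_true]
    have hiff : {e} ∪ Q.1 = {e} ∪ P.1 ↔ P = Q := by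
      refine ⟨fun h' => Subtype.ext ?_, fun h' => by rw [h']⟩
      have := congrArg (Finset.erase · e) h'
      simpa [← Finset.insert_eq, hP, hQ] using this.symm
    simp only [hiff]
    split_ifs with hPQ
    · subst hPQ
      unfold msign
      rw [← mul_pow]
      simp
    · simp
  · intro I _ hI
    rw [h, if_neg, zero_mul]
    exact fun h' => hI (Subtype.ext h'.1.symm)
  · simp

theorem ip_wedge_bform_singleton_of_ne {c e : Fin n} (hce : c ≠ e) (P Q : Idx n k)
    (hP : e ∉ P.1) :
    ip (wedge (bform {c} : Lam n 1) (bform P.1 : Lam n k) : Lam n m)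
      (wedge (bform {e} : Lam n 1) (bform Q.1 : Lam n k)) = 0 := by
  have h (d : Fin n) (R : Idx n k) (I : Idx n m) :=
    wedge_bform_bform_apply (⟨{d}, Finset.card_singleton d⟩ : Idx n 1) R I
  simp only at h
  refine Finset.sum_eq_zero fun I _ => ?_
  rw [h, h]
  split_ifs with h₁ h₂
  · have : e ∈ {c} ∪ P.1 := by rw [h₁.1, ← h₂.1]; simp
    simp [hP, hce.symm] at this
  all_goals simp

end ExteriorCoordinates

/-- **Lemma (symmetry relations).** Let `2 ≤ k ≤ n` and for each `J ∈ T¹_{k-1}` let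
`D^J ∈ Λᵏ` satisfy `e^1 ⌟ D^J = 0`.  If
`∑_{J ∈ T¹_{k-1}} ⟨D^J; a∧b⟩⟨a∧b; e^1∧e^J⟩ = 0` for all `a ∈ Λ¹`, `b ∈ Λ^{k-1}`,
then `e^R ⌟ D^S + e^S ⌟ D^R = 0` for all `R, S ∈ T¹_{k-1}` (in particular
`e^R ⌟ D^R = 0` for all `R ∈ T¹_{k-1}`). -/
theorem stmt14 {n k : ℕ} (hk : 2 ≤ k) (hkn : k ≤ n)
    (e1 : Fin n) (he1 : (e1 : ℕ) = 0)
    (D : Idx n (k-1) → Lam n k)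
    (hD : ∀ J : Idx n (k-1), e1 ∉ J.1 →
      (iprod (bform {e1} : Lam n 1) (D J) : Lam n (k-1)) = 0)
    (hmain : ∀ (a : Lam n 1) (b : Lam n (k-1)),
      ∑ J ∈ Finset.univ.filter (fun J : Idx n (k-1) => e1 ∉ J.1),
        ip (D J) (wedge a b) *
          ip ((wedge a b : Lam n k)) (wedge (bform {e1} : Lam n 1) (bform J.1 : Lam n (k-1))) = 0) :
    (∀ R S : Idx n (k-1), e1 ∉ R.1 → e1 ∉ S.1 →
      (iprod (bform R.1 : Lam n (k-1)) (D S) : Lam n 1)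
        + (iprod (bform S.1 : Lam n (k-1)) (D R) : Lam n 1) = 0) ∧
    (∀ R : Idx n (k-1), e1 ∉ R.1 →
      (iprod (bform R.1 : Lam n (k-1)) (D R) : Lam n 1) = 0) := by
  have hzero (J P : Idx n (k-1)) (hJ : e1 ∉ J.1) :
      ip (D J) (wedge (bform {e1} : Lam n 1) (bform P.1 : Lam n (k-1))) = 0 := by
    have h := iprod_bform_apply (⟨{e1}, Finset.card_singleton e1⟩ : Idx n 1) (D J) P
    simp only at h
    rw [← h, hD J hJ, Pi.zero_apply]
  have hskew (c : Fin n) (R S : Idx n (k-1)) (hR : e1 ∉ R.1) (hS : e1 ∉ S.1) :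
      ip (D S) (wedge (bform {c} : Lam n 1) (bform R.1 : Lam n (k-1))) +
        ip (D R) (wedge (bform {c} : Lam n 1) (bform S.1 : Lam n (k-1))) = 0 := by
    by_cases hc : c = e1
    · rw [hc, hzero S R hS, hzero R S hR, add_zero]
    have hdiag (J P : Idx n (k-1)) (hJ : e1 ∉ J.1) (hP : e1 ∉ P.1) :
        ip (wedge (bform {e1} + bform {c} : Lam n 1) (bform P.1 : Lam n (k-1)) : Lam n k)
          (wedge (bform {e1} : Lam n 1) (bform J.1 : Lam n (k-1))) = if P = J then 1 else 0 := by
      rw [wedge_add_left, ip_add_left, ip_wedge_bform_singleton (by omega) P J hP hJ,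
        ip_wedge_bform_singleton_of_ne hc P J hP, add_zero]
    have hval (J P : Idx n (k-1)) (hJ : e1 ∉ J.1) :
        ip (D J) (wedge (bform {e1} + bform {c} : Lam n 1) (bform P.1 : Lam n (k-1))) =
          ip (D J) (wedge (bform {c} : Lam n 1) (bform P.1 : Lam n (k-1))) := by
      rw [wedge_add_left, ip_add_right, hzero J P hJ, zero_add]
    have hself (P : Idx n (k-1)) (hP : e1 ∉ P.1) :
        ip (D P) (wedge (bform {c} : Lam n 1) (bform P.1 : Lam n (k-1))) = 0 := by
      have h := hmain (bform {e1} + bform {c}) (bform P.1)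
      rw [Finset.sum_congr rfl fun J hJ => by
        rw [hdiag J P (Finset.mem_filter.mp hJ).2 hP, hval J P (Finset.mem_filter.mp hJ).2]] at h
      simpa [hP] using h
    have h := hmain (bform {e1} + bform {c}) (bform R.1 + bform S.1)
    rw [Finset.sum_congr rfl fun J hJ => by
      rw [wedge_add_right, ip_add_left, ip_add_right, hdiag J R (Finset.mem_filter.mp hJ).2 hR,
        hdiag J S (Finset.mem_filter.mp hJ).2 hS, hval J R (Finset.mem_filter.mp hJ).2,
        hval J S (Finset.mem_filter.mp hJ).2, mul_add]] at h
    simp only [mul_ite, mul_one, mul_zero, Finset.sum_add_distrib, Finset.sum_ite_eq,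
      Finset.mem_filter, Finset.mem_univ, true_and, hR, hS, not_false_eq_true, if_true] at h
    linarith [hself R hR, hself S hS]
  have hsymm (R S : Idx n (k-1)) (hR : e1 ∉ R.1) (hS : e1 ∉ S.1) :
      (iprod (bform R.1 : Lam n (k-1)) (D S) : Lam n 1)
        + (iprod (bform S.1 : Lam n (k-1)) (D R) : Lam n 1) = 0 := by
    funext C
    obtain ⟨c, hc⟩ := Finset.card_eq_one.mp C.2
    rw [Pi.add_apply, iprod_bform_apply, iprod_bform_apply, hc, wedge_bform_singleton_comm,
      wedge_bform_singleton_comm, ip_smul_right, ip_smul_right, ← mul_add, hskew c R S hR hS,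
      mul_zero, Pi.zero_apply]
  exact ⟨hsymm, fun R hR => self_eq_neg.mp (eq_neg_of_add_eq_zero_left (hsymm R R hR hR))⟩
end

section
/- Let 2 ≤ k ≤ n and for each J ∈ T^1_{k−1} let D^J ∈ Λ^k satisfy e^1⌟D^J = 0. Assume that Σ_{J∈T^1_{k−1}} ⟨D^J; a∧b⟩⟨a∧b; e^1∧e^J⟩ = 0 for all a ∈ Λ^1 and b ∈ Λ^{k−1}. Then for every J ∈ T^1_{k−1} and every index j ∈ {1} ∪ J, one has e^j⌟D^J = 0. -/
theorem msign_ne_zero {n : ℕ} (R S : Finset (Fin n)) : msign R S ≠ 0 :=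
  pow_ne_zero _ (by norm_num)

theorem iprod_bform_apply_s15 {n j k m : ℕ} (A : Idx n j) (ω : Lam n k) (C : Idx n m) (B : Idx n k)
    (hdisj : Disjoint A.1 C.1) (hB : A.1 ∪ C.1 = B.1) :
    iprod (bform A.1 : Lam n j) ω C = msign A.1 C.1 * ω B := by
  unfold iprod bform
  rw [Finset.sum_eq_single A, Finset.sum_eq_single B]
  · simp [hdisj, hB]
  · intro B' _ hne
    rw [if_neg]
    rintro ⟨h, -⟩
    exact hne (Subtype.ext (h.symm.trans hB))
  · simp
  · intro A' _ hne
    refine Finset.sum_eq_zero fun B' _ => ?_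
    simp [Subtype.val_injective.ne hne]
  · simp

theorem iprod_bform_apply_of_not_disjoint {n j k m : ℕ} (A : Idx n j) (ω : Lam n k) (C : Idx n m)
    (hdisj : ¬ Disjoint A.1 C.1) :
    iprod (bform A.1 : Lam n j) ω C = 0 := by
  unfold iprod bform
  refine Finset.sum_eq_zero fun A' _ => Finset.sum_eq_zero fun B' _ => ?_
  by_cases h : A'.1 = A.1
  · simp [h, hdisj]
  · simp [h]

theorem wedge_bform_bform {n k l m : ℕ} (R : Idx n k) (S : Idx n l)
    (hdisj : Disjoint R.1 S.1) :
    (wedge (bform R.1 : Lam n k) (bform S.1 : Lam n l) : Lam n m) =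
      msign R.1 S.1 • bform (R.1 ∪ S.1) := by
  ext I
  unfold wedge bform
  rw [Finset.sum_eq_single R, Finset.sum_eq_single S]
  · simp [hdisj, eq_comm]
  · intro S' _ hne
    simp [Subtype.val_injective.ne hne]
  · simp
  · intro R' _ hne
    refine Finset.sum_eq_zero fun S' _ => ?_
    simp [Subtype.val_injective.ne hne]
  · simp

theorem wedge_add {n k l m : ℕ} (ω : Lam n k) (φ ψ : Lam n l) :
    (wedge ω (φ + ψ) : Lam n m) = wedge ω φ + wedge ω ψ := by
  ext I
  simp only [wedge, Pi.add_apply, ← Finset.sum_add_distrib]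
  refine Finset.sum_congr rfl fun R _ => Finset.sum_congr rfl fun S _ => ?_
  split_ifs <;> ring

theorem ip_add {n k : ℕ} (ω α β : Lam n k) : ip ω (α + β) = ip ω α + ip ω β := by
  simp [ip, mul_add, Finset.sum_add_distrib]

theorem ip_smul_bform {n k : ℕ} (ω : Lam n k) (c : ℝ) (I : Idx n k) :
    ip ω (c • bform I.1) = c * ω I := by
  unfold ip bform
  rw [Finset.sum_eq_single I]
  · simp [mul_comm]
  · intro I' _ hne
    simp [Subtype.val_injective.ne hne]
  · simp

/-- **Lemma (annihilation).** Let `2 ≤ k ≤ n` and for each `J ∈ T¹_{k-1}` let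
`D^J ∈ Λᵏ` satisfy `e^1 ⌟ D^J = 0`.  If
`∑_{J ∈ T¹_{k-1}} ⟨D^J; a∧b⟩⟨a∧b; e^1∧e^J⟩ = 0` for all `a ∈ Λ¹`, `b ∈ Λ^{k-1}`,
then `e^j ⌟ D^J = 0` for every `J ∈ T¹_{k-1}` and every `j ∈ {1} ∪ J`. -/
theorem stmt15 {n k : ℕ} (hk : 2 ≤ k) (hkn : k ≤ n)
    (e1 : Fin n) (he1 : (e1 : ℕ) = 0)
    (D : Idx n (k-1) → Lam n k)
    (hD : ∀ J : Idx n (k-1), e1 ∉ J.1 →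
      (iprod (bform {e1} : Lam n 1) (D J) : Lam n (k-1)) = 0)
    (hmain : ∀ (a : Lam n 1) (b : Lam n (k-1)),
      ∑ J ∈ Finset.univ.filter (fun J : Idx n (k-1) => e1 ∉ J.1),
        ip (D J) (wedge a b) *
          ip ((wedge a b : Lam n k)) (wedge (bform {e1} : Lam n 1) (bform J.1 : Lam n (k-1))) = 0) :
    ∀ J : Idx n (k-1), e1 ∉ J.1 → ∀ j : Fin n, (j = e1 ∨ j ∈ J.1) →
      (iprod (bform {j} : Lam n 1) (D J) : Lam n (k-1)) = 0 := by
  intro J hJ j hj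
  rcases eq_or_ne j e1 with rfl | hj1
  · exact hD J hJ
  have hjJ : j ∈ J.1 := hj.resolve_left hj1
  have vanish : ∀ J' : Idx n (k-1), e1 ∉ J'.1 → ∀ I : Idx n k, e1 ∈ I.1 → D J' I = 0 := by
    intro J' hJ' I hI
    let C : Idx n (k-1) := ⟨I.1.erase e1, by rw [Finset.card_erase_of_mem hI, I.2]⟩
    have h := congrFun (hD J' hJ') C
    rw [iprod_bform_apply_s15 ⟨{e1}, Finset.card_singleton e1⟩ (D J') C I (by simp [C])
      (by simp [C, hI])] at h
    exact (mul_eq_zero.mp h).resolve_left (msign_ne_zero _ _)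
  ext C
  by_cases hjC : j ∈ C.1
  · exact iprod_bform_apply_of_not_disjoint ⟨{j}, Finset.card_singleton j⟩ _ C (by simpa using hjC)
  let I : Idx n k := ⟨{j} ∪ C.1, by
    rw [Finset.card_union_of_disjoint (by simpa using hjC), C.2, Finset.card_singleton]; omega⟩
  rw [iprod_bform_apply_s15 ⟨{j}, Finset.card_singleton j⟩ (D J) C I (by simpa using hjC) rfl]
  by_cases h1C : e1 ∈ C.1
  · rw [vanish J hJ I (by simp [I, h1C]), mul_zero, Pi.zero_apply]
  have h1I : e1 ∉ I.1 := by simp [I, h1C, hj1.symm]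
  let K : Idx n (k-1) := ⟨insert e1 (J.1.erase j), by
    rw [Finset.card_insert_of_notMem (by simp [hJ]), Finset.card_erase_of_mem hjJ, J.2]; omega⟩
  have hjK : j ∉ K.1 := by simp [K, hj1]
  let e1J (J' : Idx n (k-1)) (h : e1 ∉ J'.1) : Idx n k := ⟨{e1} ∪ J'.1, by
    rw [Finset.card_union_of_disjoint (by simpa using h), J'.2, Finset.card_singleton]; omega⟩
  have hjK_union : {j} ∪ K.1 = (e1J J hJ).1 := by
    ext x
    simp only [K, e1J, Finset.mem_union, Finset.mem_insert, Finset.mem_erase,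
      Finset.mem_singleton]
    by_cases hx : x = j
    · simp [hx, hjJ]
    · simp [hx]
  have hwedge : (wedge (bform {j} : Lam n 1) (bform C.1 + bform K.1 : Lam n (k-1)) : Lam n k) =
      msign {j} C.1 • bform I.1 + msign {j} K.1 • bform (e1J J hJ).1 := by
    rw [wedge_add, wedge_bform_bform ⟨{j}, Finset.card_singleton j⟩ C (by simpa using hjC),
      wedge_bform_bform ⟨{j}, Finset.card_singleton j⟩ K (by simpa using hjK), ← hjK_union]
  have key := hmain (bform {j}) (bform C.1 + bform K.1)
  have hterm : ∀ J' : Idx n (k-1), e1 ∉ J'.1 →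
      ip (D J') (wedge (bform {j} : Lam n 1) (bform C.1 + bform K.1 : Lam n (k-1))) *
        ip (wedge (bform {j} : Lam n 1) (bform C.1 + bform K.1 : Lam n (k-1)) : Lam n k)
          (wedge (bform {e1} : Lam n 1) (bform J'.1 : Lam n (k-1))) =
      if J' = J then
        (msign {j} C.1 * D J I) * (msign {e1} J.1 * msign {j} K.1) else 0 := by
    intro J' hJ'
    have hne : (e1J J' hJ').1 ≠ I.1 := fun h => h1I (h ▸ by simp [e1J])
    have hiff : (e1J J' hJ').1 = (e1J J hJ).1 ↔ J' = J := by
      refine ⟨fun h => Subtype.ext ?_, fun h => by subst h; rfl⟩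
      have h' := congrArg (fun s => s.erase e1) h
      simpa [e1J, ← Finset.insert_eq, Finset.erase_insert, hJ, hJ'] using h'
    rw [hwedge, wedge_bform_bform ⟨{e1}, Finset.card_singleton e1⟩ J' (by simpa using hJ'),
      ip_add, ip_smul_bform, ip_smul_bform, vanish J' hJ' (e1J J hJ) (by simp [e1J]),
      show ({e1} ∪ J'.1 : Finset (Fin n)) = (e1J J' hJ').1 from rfl, ip_smul_bform]
    simp only [Pi.add_apply, Pi.smul_apply, bform, smul_eq_mul, if_neg hne, hiff]
    split_ifs with h
    · subst h; ring
    · ring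
  rw [Finset.sum_congr rfl fun J' hJ' => hterm J' (Finset.mem_filter.mp hJ').2,
    Finset.sum_ite_eq' _ J, if_pos (by simpa using hJ)] at key
  exact (mul_eq_zero.mp key).resolve_right
    (mul_ne_zero (msign_ne_zero _ _) (msign_ne_zero _ _))
end
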